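/- arXiv:2605.29405 — 3 statements merged into one kernel-verified Lean document; each statement's English description precedes it below -/
import Mathlib

section
/- Let T be a positive natural number, let Π be a nonempty set, and for each t ∈ {1, …, T} let Δ_t, g_t : Π → ℝ be functions with Δ_t(π) ≥ 0 and g_t(π) ≥ 0 for every π ∈ Π. Let η ≥ 0 and C ≥ 0. Suppose for each t there exists π_ref_t ∈ Π with Δ_t(π_ref_t)² ≤ C·g_t(π_ref_t) and g_t(π_ref_t) + η > 0, and suppose each π_t ∈ Π satisfies the cross-multiplied ratio minimality Δ_t(π_t)²·(g_t(π) + η) ≤ Δ_t(π)²·(g_t(π_t) + η) for every π ∈ Π. Then ∑_{t=1}^T Δ_t(π_t) ≤ √( T · C · ( ∑_{t=1}^T g_t(π_t) + T·η ) ). -/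
/-- Combined deterministic skeleton of the ratio certificate (Lemma 4.1) and the
master inequality (Proposition 4.2): at each round the executed policy minimizes
the regularised ratio, a reference policy certifies the ratio bound with
constant `C`, and Cauchy–Schwarz over rounds yields the cumulative bound. -/
theorem ids_cumulative_bound (T : ℕ) (hT : 0 < T)
    {Pol : Type*} [Nonempty Pol]
    (Δ g : ℕ → Pol → ℝ)
    (hΔ : ∀ t ∈ Finset.Icc 1 T, ∀ π : Pol, 0 ≤ Δ t π)
    (hg : ∀ t ∈ Finset.Icc 1 T, ∀ π : Pol, 0 ≤ g t π)
    (η C : ℝ) (hη : 0 ≤ η) (hC : 0 ≤ C)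
    (πref : ℕ → Pol)
    (href : ∀ t ∈ Finset.Icc 1 T, (Δ t (πref t)) ^ 2 ≤ C * g t (πref t))
    (hrefpos : ∀ t ∈ Finset.Icc 1 T, 0 < g t (πref t) + η)
    (πt : ℕ → Pol)
    (hmin : ∀ t ∈ Finset.Icc 1 T, ∀ π : Pol,
      (Δ t (πt t)) ^ 2 * (g t π + η) ≤ (Δ t π) ^ 2 * (g t (πt t) + η)) :
    ∑ t ∈ Finset.Icc 1 T, Δ t (πt t)
      ≤ Real.sqrt ((T : ℝ) * C * (∑ t ∈ Finset.Icc 1 T, g t (πt t) + (T : ℝ) * η)) := by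
  have key : ∀ t ∈ Finset.Icc 1 T, Δ t (πt t) ^ 2 ≤ C * (g t (πt t) + η) := by
    intro t ht
    have hexec : 0 ≤ g t (πt t) + η := add_nonneg (hg t ht _) hη
    refine le_of_mul_le_mul_right ?_ (hrefpos t ht)
    calc Δ t (πt t) ^ 2 * (g t (πref t) + η)
        ≤ Δ t (πref t) ^ 2 * (g t (πt t) + η) := hmin t ht (πref t)
      _ ≤ C * (g t (πref t) + η) * (g t (πt t) + η) := by
          refine mul_le_mul_of_nonneg_right ((href t ht).trans ?_) hexec
          exact mul_le_mul_of_nonneg_left (le_add_of_nonneg_right hη) hC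
      _ = C * (g t (πt t) + η) * (g t (πref t) + η) := by ring
  apply Real.le_sqrt_of_sq_le
  calc (∑ t ∈ Finset.Icc 1 T, Δ t (πt t)) ^ 2
      ≤ (T : ℝ) * ∑ t ∈ Finset.Icc 1 T, Δ t (πt t) ^ 2 := by
        simpa using sq_sum_le_card_mul_sum_sq (s := Finset.Icc 1 T) (f := fun t => Δ t (πt t))
    _ ≤ (T : ℝ) * ∑ t ∈ Finset.Icc 1 T, C * (g t (πt t) + η) :=
        mul_le_mul_of_nonneg_left (Finset.sum_le_sum key) T.cast_nonneg
    _ = (T : ℝ) * C * (∑ t ∈ Finset.Icc 1 T, g t (πt t) + (T : ℝ) * η) := by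
        rw [← Finset.mul_sum, Finset.sum_add_distrib]
        simp [mul_assoc]
end

section
/- Let d and T be positive natural numbers, let Λ₀ be a real symmetric positive definite d×d matrix with smallest eigenvalue λ_min(Λ₀) > 0, let φ_1, …, φ_T ∈ ℝ^d with ‖φ_t‖ ≤ 1 for every t, and set Λ_T := Λ₀ + ∑_{t=1}^T φ_t φ_tᵀ. Then log det Λ_T − log det Λ₀ ≤ d · log( 1 + T / (d · λ_min(Λ₀)) ). -/
open Matrix

open scoped MatrixOrder in
/-- A positive definite matrix is the square of a positive semidefinite matrix. -/
theorem Matrix.PosDef.exists_posSemidef_mul_self_eq {n : Type*} [Fintype n] [DecidableEq n]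
    {A : Matrix n n ℝ} (hA : A.PosDef) : ∃ B : Matrix n n ℝ, B.PosSemidef ∧ B * B = A :=
  ⟨CFC.sqrt A, nonneg_iff_posSemidef.mp (CFC.sqrt_nonneg A),
    CFC.sqrt_mul_sqrt_self A hA.posSemidef.nonneg⟩

open scoped MatrixOrder in
theorem Matrix.IsHermitian.posSemidef_sub_smul_one {n : Type*} [Fintype n] [DecidableEq n]
    {A : Matrix n n ℝ} (hA : A.IsHermitian) {c : ℝ} (hc : ∀ i, c ≤ hA.eigenvalues i) :
    (A - c • (1 : Matrix n n ℝ)).PosSemidef := by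
  rw [← le_iff, ← Algebra.algebraMap_eq_smul_one,
    algebraMap_le_iff_le_spectrum (ha := hA.isSelfAdjoint), hA.spectrum_real_eq_range_eigenvalues]
  rintro _ ⟨i, rfl⟩
  exact hc i

/-- The **AM-GM inequality** for the eigenvalues of a positive definite matrix. -/
theorem Matrix.PosDef.log_det_le {n : Type*} [Fintype n] [DecidableEq n] [Nonempty n]
    {A : Matrix n n ℝ} (hA : A.PosDef) :
    Real.log A.det ≤ Fintype.card n * Real.log (A.trace / Fintype.card n) := by
  have hn : (0 : ℝ) < Fintype.card n := by exact_mod_cast Fintype.card_pos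
  set m : ℝ := A.trace / Fintype.card n with hm
  have hm0 : 0 < m := div_pos hA.trace_pos hn
  have htr : ∑ i, hA.1.eigenvalues i = Fintype.card n * m := by
    have := hA.1.trace_eq_sum_eigenvalues
    simp only [RCLike.ofReal_real_eq_id, id] at this
    rw [← this, hm]
    field_simp
  have hlog : ∀ i, Real.log (hA.1.eigenvalues i) ≤
      Real.log m + (hA.1.eigenvalues i / m - 1) := fun i => by
    have := Real.log_le_sub_one_of_pos (div_pos (hA.eigenvalues_pos i) hm0)
    rw [Real.log_div (hA.eigenvalues_pos i).ne' hm0.ne'] at this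
    linarith
  calc Real.log A.det = ∑ i, Real.log (hA.1.eigenvalues i) := by
        rw [hA.1.det_eq_prod_eigenvalues]
        exact Real.log_prod fun i _ => (hA.eigenvalues_pos i).ne'
    _ ≤ ∑ i, (Real.log m + (hA.1.eigenvalues i / m - 1)) := Finset.sum_le_sum fun i _ => hlog i
    _ = Fintype.card n * Real.log m := by
        rw [Finset.sum_add_distrib, Finset.sum_sub_distrib, ← Finset.sum_div, htr]
        simp [hm0.ne']

/-- If `A` is at least `c` in the Loewner order, then `A⁻¹` is at most `c⁻¹`. -/
theorem Matrix.PosDef.dotProduct_inv_mulVec_le {n : Type*} [Fintype n] [DecidableEq n]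
    {A : Matrix n n ℝ} (hA : A.PosDef) {c : ℝ} (hc0 : 0 < c)
    (hc : (A - c • (1 : Matrix n n ℝ)).PosSemidef) (v : n → ℝ) :
    v ⬝ᵥ A⁻¹ *ᵥ v ≤ (v ⬝ᵥ v) / c := by
  obtain ⟨B, hB, hBB⟩ := hA.inv.exists_posSemidef_mul_self_eq
  have hdet : IsUnit A.det := hA.det_pos.ne'.isUnit
  have hBAB : B * A * B = 1 := by
    refine mul_eq_one_comm.mp ?_
    rw [← mul_assoc, hBB, nonsing_inv_mul _ hdet]
  have hpsd : (1 - c • A⁻¹).PosSemidef := by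
    have := hc.mul_mul_conjTranspose_same B
    rwa [hB.1.eq, mul_sub, sub_mul, hBAB, Matrix.mul_smul, mul_one, smul_mul, hBB] at this
  have := hpsd.dotProduct_mulVec_nonneg v
  rw [sub_mulVec, one_mulVec, smul_mulVec, star_trivial, dotProduct_sub, dotProduct_smul,
    smul_eq_mul] at this
  rw [le_div_iff₀ hc0]
  linarith

/-- Adding a positive semidefinite matrix `M` to `A` increases the log-determinant by an amount
controlled by the trace of `A⁻¹ * M`. -/
theorem Matrix.PosDef.log_det_add_sub_log_det_le {n : Type*} [Fintype n] [DecidableEq n]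
    [Nonempty n] {A M : Matrix n n ℝ} (hA : A.PosDef) (hM : M.PosSemidef) :
    Real.log (A + M).det - Real.log A.det ≤
      Fintype.card n * Real.log (1 + (A⁻¹ * M).trace / Fintype.card n) := by
  obtain ⟨B, hB, hBB⟩ := hA.inv.exists_posSemidef_mul_self_eq
  have hdet : IsUnit A.det := hA.det_pos.ne'.isUnit
  have hBu : IsUnit B := by
    have : IsUnit (B * B) := hBB ▸ hA.inv.isUnit
    exact isUnit_of_mul_isUnit_left this
  have hAM : (A + M).PosDef := hA.add_posSemidef hM
  have hN : (B * (A + M) * B).PosDef := by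
    have := (hBu.posDef_star_left_conjugate_iff (x := A + M)).mpr hAM
    rwa [star_eq_conjTranspose, hB.1.eq] at this
  have hn : (Fintype.card n : ℝ) ≠ 0 := by exact_mod_cast Fintype.card_ne_zero
  have hNdet : (B * (A + M) * B).det = (A + M).det / A.det := by
    rw [det_mul, det_mul, mul_right_comm, ← det_mul, hBB, det_nonsing_inv, Ring.inverse_eq_inv']
    ring
  have hNtr : (B * (A + M) * B).trace / Fintype.card n =
      1 + (A⁻¹ * M).trace / Fintype.card n := by
    rw [trace_mul_comm, ← mul_assoc, hBB, mul_add, nonsing_inv_mul _ hdet, trace_add, trace_one,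
      add_div, div_self hn]
  have := hN.log_det_le
  rwa [hNdet, hNtr, Real.log_div hAM.det_pos.ne' hA.det_pos.ne'] at this

/-- Elliptical-potential bound (online branch of Theorem 4.5): after `T`
rank-one updates by unit-norm-bounded feature vectors, the log-determinant of
the Gram matrix grows by at most `d·log(1 + T/(d·λ_min(Λ₀)))`. -/
theorem elliptical_potential (d T : ℕ) (hd : 0 < d) (hT : 0 < T)
    (Λ₀ : Matrix (Fin d) (Fin d) ℝ) (hsym : Λ₀.IsHermitian) (hpd : Λ₀.PosDef)
    (φ : ℕ → Fin d → ℝ)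
    (hφ : ∀ t < T, Real.sqrt (∑ i, φ t i ^ 2) ≤ 1) :
    Real.log (Λ₀ + ∑ t ∈ Finset.range T, vecMulVec (φ t) (φ t)).det
        - Real.log Λ₀.det
      ≤ (d : ℝ) * Real.log (1 + (T : ℝ) / ((d : ℝ) * ⨅ i, hsym.eigenvalues i)) := by
  have : Nonempty (Fin d) := ⟨⟨0, hd⟩⟩
  set c : ℝ := ⨅ i, hsym.eigenvalues i
  have hc0 : 0 < c := by
    obtain ⟨i, hi⟩ := exists_eq_ciInf_of_finite (f := hsym.eigenvalues)
    exact (hpd.eigenvalues_pos i).trans_eq hi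
  have hc : (Λ₀ - c • (1 : Matrix (Fin d) (Fin d) ℝ)).PosSemidef :=
    hsym.posSemidef_sub_smul_one fun i => ciInf_le (Set.finite_range _).bddBelow i
  have hM : (∑ t ∈ Finset.range T, vecMulVec (φ t) (φ t)).PosSemidef :=
    posSemidef_sum _ fun t _ => by simpa using posSemidef_vecMulVec_self_star (φ t)
  have htr : (Λ₀⁻¹ * ∑ t ∈ Finset.range T, vecMulVec (φ t) (φ t)).trace =
      ∑ t ∈ Finset.range T, φ t ⬝ᵥ Λ₀⁻¹ *ᵥ φ t := by
    simp_rw [Finset.mul_sum, trace_sum, mul_vecMulVec, trace_vecMulVec, dotProduct_comm]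
  have hnonneg : 0 ≤ ∑ t ∈ Finset.range T, φ t ⬝ᵥ Λ₀⁻¹ *ᵥ φ t :=
    Finset.sum_nonneg fun t _ => by
      simpa using hpd.inv.posSemidef.dotProduct_mulVec_nonneg (φ t)
  have hle : ∑ t ∈ Finset.range T, φ t ⬝ᵥ Λ₀⁻¹ *ᵥ φ t ≤ T / c := by
    have hterm : ∀ t ∈ Finset.range T, φ t ⬝ᵥ Λ₀⁻¹ *ᵥ φ t ≤ 1 / c := fun t ht => by
      have hsq : φ t ⬝ᵥ φ t ≤ 1 := by
        simpa [dotProduct, sq] using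
          (Real.sqrt_le_left zero_le_one).mp (hφ t (Finset.mem_range.mp ht))
      exact (hpd.dotProduct_inv_mulVec_le hc0 hc (φ t)).trans (by gcongr)
    calc _ ≤ ∑ _t ∈ Finset.range T, 1 / c := Finset.sum_le_sum hterm
      _ = T / c := by simp [div_eq_mul_inv]
  refine (hpd.log_det_add_sub_log_det_le hM).trans ?_
  rw [htr, Fintype.card_fin, mul_comm (d : ℝ) c, ← div_div]
  gcongr
end

section
/- Let p ∈ (0,1), let Δ₊ > 0 and Δ₋ > 0, let T be a positive natural number, and let X be a random variable with the geometric distribution on ℕ with success probability p (P(X = n) = (1 − p)^n · p, counting failures before the first success). Then p·Δ₊·E[min(X, T)] + (1 − p)·Δ₋·P(X ≤ T − 1) = (1 − p)(1 − (1 − p)^T)(Δ₊ + Δ₋); consequently, if T ≥ 1/p, then p·Δ₊·E[min(X, T)] + (1 − p)·Δ₋·P(X ≤ T − 1) ≥ (1 − p)(1 − e^{−1})(Δ₊ + Δ₋). -/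
open MeasureTheory ProbabilityTheory

section Geometric

variable {Ω : Type*} [MeasurableSpace Ω] {μ : Measure Ω} {X : Ω → ℕ} {p : ℝ}

lemma measureReal_lt_of_geometric [IsProbabilityMeasure μ] (hp0 : 0 ≤ p) (hp1 : p ≤ 1)
    (hXm : Measurable X) (hX : ∀ n : ℕ, μ {ω | X ω = n} = ENNReal.ofReal ((1 - p) ^ n * p))
    (k : ℕ) : μ.real {ω | X ω < k} = 1 - (1 - p) ^ k := by
  induction k with
  | zero => simp
  | succ k ih =>
    have hset : {ω | X ω < k + 1} = {ω | X ω < k} ∪ {ω | X ω = k} := by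
      ext ω
      simp only [Set.mem_ofPred_eq, Set.mem_union]
      omega
    have hdisj : Disjoint {ω | X ω < k} {ω | X ω = k} :=
      Set.disjoint_left.2 fun ω h₁ h₂ => h₁.ne h₂
    have hmass : μ.real {ω | X ω = k} = (1 - p) ^ k * p := by
      rw [measureReal_def, hX, ENNReal.toReal_ofReal]
      exact mul_nonneg (pow_nonneg (sub_nonneg.2 hp1) k) hp0
    rw [hset, measureReal_union hdisj (hXm (measurableSet_singleton k)), ih, hmass]
    ring

lemma integrable_min_natCast [IsFiniteMeasure μ] (hXm : Measurable X) (k : ℕ) :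
    Integrable (fun ω => min (X ω : ℝ) k) μ := by
  refine Integrable.of_bound (C := k) (by fun_prop) (ae_of_all _ fun ω => ?_)
  rw [Real.norm_of_nonneg (by positivity)]
  exact min_le_right _ _

lemma integral_min_of_geometric [IsProbabilityMeasure μ] (hp0 : 0 ≤ p) (hp1 : p ≤ 1)
    (hXm : Measurable X) (hX : ∀ n : ℕ, μ {ω | X ω = n} = ENNReal.ofReal ((1 - p) ^ n * p))
    (k : ℕ) : p * ∫ ω, min (X ω : ℝ) k ∂μ = (1 - p) * (1 - (1 - p) ^ k) := by
  induction k with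
  | zero => simp
  | succ k ih =>
    have hmeas : MeasurableSet {ω | X ω < k + 1} := hXm measurableSet_Iio
    have hstep : (fun ω => min (X ω : ℝ) ((k + 1 : ℕ) : ℝ)) =
        fun ω => min (X ω : ℝ) k + {ω | X ω < k + 1}ᶜ.indicator 1 ω := by
      ext ω
      by_cases h : X ω < k + 1
      · have h' : X ω ≤ k := by omega
        rw [← Nat.cast_min, ← Nat.cast_min, min_eq_left h', min_eq_left h.le]
        simp [Set.indicator, h']
      · have h' : k + 1 ≤ X ω := by omega
        have hk : k ≤ X ω := by omega
        rw [← Nat.cast_min, ← Nat.cast_min, min_eq_right h', min_eq_right hk]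
        simp [Set.indicator, Nat.lt_of_succ_le h']
    have hind : Integrable ({ω | X ω < k + 1}ᶜ.indicator (1 : Ω → ℝ)) μ :=
      (integrable_const (1 : ℝ)).indicator hmeas.compl
    rw [hstep, integral_add (integrable_min_natCast hXm k) hind,
      integral_indicator_one hmeas.compl, probReal_compl_eq_one_sub hmeas,
      measureReal_lt_of_geometric hp0 hp1 hXm hX, mul_add, ih]
    ring

end Geometric

lemma one_sub_pow_le_exp_neg_one {p : ℝ} (hp0 : 0 < p) (hp1 : p ≤ 1) {n : ℕ}
    (hn : 1 / p ≤ n) : (1 - p) ^ n ≤ Real.exp (-1) := by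
  calc (1 - p) ^ n ≤ Real.exp (-p) ^ n :=
        pow_le_pow_left₀ (sub_nonneg.2 hp1) (Real.one_sub_le_exp_neg p) n
    _ = Real.exp (n * -p) := (Real.exp_nat_mul _ _).symm
    _ ≤ Real.exp (-1) := by
        rw [div_le_iff₀ hp0] at hn
        exact Real.exp_le_exp.2 (by linarith)

/-- Probabilistic core of the Thompson-sampling regret lower bound
(Theorem 5.1, part (iii)): with `X` geometric on `ℕ` with parameter `p`,
`p·Δ₊·E[min(X,T)] + (1−p)·Δ₋·P(X ≤ T−1) = (1−p)(1−(1−p)^T)(Δ₊+Δ₋)`, and for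
`T ≥ 1/p` this is at least `(1−p)(1−e^{−1})(Δ₊+Δ₋)`. -/
theorem ts_regret_lower_bound (p : ℝ) (hp0 : 0 < p) (hp1 : p < 1)
    (Δp Δm : ℝ) (hΔp : 0 < Δp) (hΔm : 0 < Δm)
    {Ω : Type*} [MeasureSpace Ω] [IsProbabilityMeasure (ℙ : Measure Ω)]
    (X : Ω → ℕ) (hXm : Measurable X)
    (hX : ∀ n : ℕ, (ℙ : Measure Ω) {ω : Ω | X ω = n} = ENNReal.ofReal ((1 - p) ^ n * p))
    (T : ℕ) (hT : 0 < T) :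
    p * Δp * (∫ ω, (min (X ω) T : ℝ) ∂(ℙ : Measure Ω))
        + (1 - p) * Δm * ((ℙ : Measure Ω) {ω : Ω | X ω ≤ T - 1}).toReal
      = (1 - p) * (1 - (1 - p) ^ T) * (Δp + Δm) ∧
    ((1 : ℝ) / p ≤ T →
      (1 - p) * (1 - Real.exp (-1)) * (Δp + Δm)
        ≤ p * Δp * (∫ ω, (min (X ω) T : ℝ) ∂(ℙ : Measure Ω))
            + (1 - p) * Δm * ((ℙ : Measure Ω) {ω : Ω | X ω ≤ T - 1}).toReal) := by
  have hset : {ω : Ω | X ω ≤ T - 1} = {ω | X ω < T} := by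
    ext ω
    simp only [Set.mem_ofPred_eq]
    omega
  have hprob := measureReal_lt_of_geometric hp0.le hp1.le hXm hX T
  have hint := integral_min_of_geometric hp0.le hp1.le hXm hX T
  have heq : p * Δp * (∫ ω, (min (X ω) T : ℝ) ∂(ℙ : Measure Ω))
        + (1 - p) * Δm * ((ℙ : Measure Ω) {ω : Ω | X ω ≤ T - 1}).toReal
      = (1 - p) * (1 - (1 - p) ^ T) * (Δp + Δm) := by
    rw [hset, ← measureReal_def, hprob]
    linear_combination Δp * hint
  refine ⟨heq, fun hTp => ?_⟩
  rw [heq]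
  have hq : 0 ≤ 1 - p := sub_nonneg.2 hp1.le
  have hpow := one_sub_pow_le_exp_neg_one hp0 hp1.le hTp
  gcongr
end
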